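/- Suppose A ∈ ℝ^{d×d} is square and nonsingular, and let F be the (6d)×(6d) real block matrix F = [[I_d, −(α+β₁)A, 0, β₁(1+γ)A, −β₂I_d, 0], [(α+β₁)Aᵀ, I_d, −β₁(1+γ)Aᵀ, 0, 0, β₂I_d], [I_d, 0, 0, 0, 0, 0], [0, I_d, 0, 0, 0, 0], [0, 0, 0, 0, τI_d, 0], [0, 0, 0, 0, 0, τI_d]]. Then a complex number λ is an eigenvalue of F if and only if (τ−λ)² · [λ²(1−λ)² + (λ(α+β₁) − β₁(1+γ))²·ξ²] = 0 for some ξ² in the spectrum of AᵀA. -/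

import Mathlib

open Matrix

/-- The `(6d) × (6d)` block matrix of the ACG iteration for the bilinear game
`min_θ max_φ θᵀAφ`, with blocks indexed by `Fin 6`. -/
def ACGMatrix (d : ℕ) (A : Matrix (Fin d) (Fin d) ℝ) (α β₁ β₂ γ τ : ℝ) :
    Matrix (Fin 6 × Fin d) (Fin 6 × Fin d) ℝ :=
  Matrix.of fun p q =>
    (!![(1 : Matrix (Fin d) (Fin d) ℝ), (-(α + β₁)) • A, 0, (β₁ * (1 + γ)) • A,
          (-β₂) • (1 : Matrix (Fin d) (Fin d) ℝ), 0;
        (α + β₁) • Aᵀ, 1, (-(β₁ * (1 + γ))) • Aᵀ, 0, 0, β₂ • 1;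
        1, 0, 0, 0, 0, 0;
        0, 1, 0, 0, 0, 0;
        0, 0, 0, 0, τ • 1, 0;
        0, 0, 0, 0, 0, τ • 1] : Matrix (Fin 6) (Fin 6) (Matrix (Fin d) (Fin d) ℝ))
      p.1 q.1 p.2 q.2

lemma acg_mem_spectrum_iff {n K : Type*} [Fintype n] [DecidableEq n] [Field K]
    (M : Matrix n n K) (x : K) :
    x ∈ spectrum K M ↔ (Matrix.scalar n x - M).det = 0 := by
  rw [spectrum.mem_iff, Matrix.isUnit_iff_isUnit_det, isUnit_iff_ne_zero, not_not]
  rfl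

lemma acg_mem_spectrum_iff_right {n K : Type*} [Fintype n] [DecidableEq n] [Field K]
    (M : Matrix n n K) (x : K) :
    x ∈ spectrum K M ↔ ∃ v : n → K, v ≠ 0 ∧ M *ᵥ v = x • v := by
  rw [acg_mem_spectrum_iff, ← Matrix.exists_mulVec_eq_zero_iff]
  refine exists_congr fun v => and_congr_right fun _ => ?_
  rw [Matrix.sub_mulVec, sub_eq_zero, eq_comm]
  simp [← Matrix.smul_one_eq_diagonal, Matrix.smul_mulVec]

lemma acg_mem_spectrum_iff_left {n K : Type*} [Fintype n] [DecidableEq n] [Field K]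
    (M : Matrix n n K) (x : K) :
    x ∈ spectrum K M ↔ ∃ v : n → K, v ≠ 0 ∧ v ᵥ* M = x • v := by
  rw [acg_mem_spectrum_iff, ← Matrix.exists_vecMul_eq_zero_iff]
  refine exists_congr fun v => and_congr_right fun _ => ?_
  rw [Matrix.vecMul_sub, sub_eq_zero, eq_comm]
  simp [← Matrix.smul_one_eq_diagonal, Matrix.vecMul_smul]

lemma acg_spectrum_map {n : Type*} [Fintype n] [DecidableEq n]
    (M : Matrix n n ℝ) (x : ℝ) :
    x ∈ spectrum ℝ M ↔ (x : ℂ) ∈ spectrum ℂ (M.map (algebraMap ℝ ℂ)) := by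
  rw [acg_mem_spectrum_iff, acg_mem_spectrum_iff]
  have : (Matrix.scalar n (x : ℂ) - M.map (algebraMap ℝ ℂ)) =
      (algebraMap ℝ ℂ).mapMatrix (Matrix.scalar n x - M) := by
    ext i j
    by_cases h : i = j <;> simp [h]
  rw [this, ← RingHom.map_det]
  simp

lemma acg_real_of_spectrum {n : Type*} [Fintype n] [DecidableEq n]
    (M : Matrix n n ℝ) (hM : Mᵀ = M) (μ : ℂ)
    (h : μ ∈ spectrum ℂ (M.map (algebraMap ℝ ℂ))) :
    ∃ x ∈ spectrum ℝ M, μ = (x : ℂ) := by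
  have hH : (M.map (algebraMap ℝ ℂ)).IsHermitian := by
    ext i j
    have := congrFun (congrFun hM i) j
    simp only [Matrix.transpose_apply] at this
    simp [this]
  have h' := h
  rw [hH.spectrum_eq_image_range] at h'
  obtain ⟨x, -, rfl⟩ := h'
  exact ⟨x, (acg_spectrum_map M x).2 h, rfl⟩

lemma acg_forall_six (P : Fin 6 → Prop) :
    (∀ i, P i) ↔ P 0 ∧ P 1 ∧ P 2 ∧ P 3 ∧ P 4 ∧ P 5 := by
  constructor
  · intro h
    exact ⟨h 0, h 1, h 2, h 3, h 4, h 5⟩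
  · rintro ⟨h0, h1, h2, h3, h4, h5⟩ i
    fin_cases i
    exacts [h0, h1, h2, h3, h4, h5]

lemma acg_eigen_iff (d : ℕ) (A : Matrix (Fin d) (Fin d) ℝ)
    (α β₁ β₂ γ τ : ℝ) (lam : ℂ) (v : Fin 6 × Fin d → ℂ) :
    ((ACGMatrix d A α β₁ β₂ γ τ).map (algebraMap ℝ ℂ)) *ᵥ v = lam • v ↔
     ((fun k => v (0, k)) - ((α : ℂ) + β₁) • (A.map (algebraMap ℝ ℂ) *ᵥ fun k => v (1, k))
        + ((β₁ : ℂ) * (1 + γ)) • (A.map (algebraMap ℝ ℂ) *ᵥ fun k => v (3, k))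
        - (β₂ : ℂ) • (fun k => v (4, k)) = lam • fun k => v (0, k)) ∧
     (((α : ℂ) + β₁) • ((A.map (algebraMap ℝ ℂ))ᵀ *ᵥ fun k => v (0, k)) + (fun k => v (1, k))
        - ((β₁ : ℂ) * (1 + γ)) • ((A.map (algebraMap ℝ ℂ))ᵀ *ᵥ fun k => v (2, k))
        + (β₂ : ℂ) • (fun k => v (5, k)) = lam • fun k => v (1, k)) ∧
     ((fun k => v (0, k)) = lam • fun k => v (2, k)) ∧
     ((fun k => v (1, k)) = lam • fun k => v (3, k)) ∧
     ((τ : ℂ) • (fun k => v (4, k)) = lam • fun k => v (4, k)) ∧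
     ((τ : ℂ) • (fun k => v (5, k)) = lam • fun k => v (5, k)) := by
  have key : ∀ (i : Fin 6), (∀ k, (((ACGMatrix d A α β₁ β₂ γ τ).map (algebraMap ℝ ℂ)) *ᵥ v) (i, k)
      = lam * v (i, k)) ↔ ∀ k, ∑ j : Fin 6, ∑ l, ((ACGMatrix d A α β₁ β₂ γ τ (i,k) (j,l) : ℝ) : ℂ) * v (j,l)
        = lam * v (i,k) := by
    intro i
    simp [Matrix.mulVec, dotProduct, Fintype.sum_prod_type]
  have h1 : ∀ k (w : Fin d → ℂ), ∑ l, (((1 : Matrix (Fin d) (Fin d) ℝ) k l : ℝ) : ℂ) * w l = w k := by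
    intro k w
    rw [Finset.sum_eq_single k]
    · simp
    · intro l _ hl
      simp [Matrix.one_apply_ne hl.symm]
    · simp
  have h2 : ∀ (c : ℝ) (C : Matrix (Fin d) (Fin d) ℝ) k (w : Fin d → ℂ),
      ∑ l, (((c • C) k l : ℝ) : ℂ) * w l = c * ∑ l, ((C k l : ℝ) : ℂ) * w l := by
    intro c C k w
    simp [Finset.mul_sum, mul_assoc]
  have h0 : ∀ k (w : Fin d → ℂ), ∑ l, (((0 : Matrix (Fin d) (Fin d) ℝ) k l : ℝ) : ℂ) * w l = 0 := by
    intro k w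
    simp
  have hA' : ∀ k (w : Fin d → ℂ), ∑ l, ((A k l : ℝ) : ℂ) * w l
      = (A.map (algebraMap ℝ ℂ) *ᵥ w) k := fun k w => rfl
  have hAt : ∀ k (w : Fin d → ℂ), ∑ l, ((Aᵀ k l : ℝ) : ℂ) * w l
      = ((A.map (algebraMap ℝ ℂ))ᵀ *ᵥ w) k := fun k w => rfl
  rw [funext_iff, Prod.forall, acg_forall_six]
  simp only [Pi.smul_apply, smul_eq_mul, key]
  simp only [Fin.sum_univ_six, ACGMatrix, Matrix.of_apply, Matrix.cons_val', Matrix.cons_val]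
  simp only [h0 _ (fun l => v (_, l)), h1 _ (fun l => v (_, l)), h2 _ _ _ (fun l => v (_, l)),
    hA' _ (fun l => v (_, l)), hAt _ (fun l => v (_, l)), funext_iff, Pi.add_apply, Pi.sub_apply,
    Pi.smul_apply, smul_eq_mul, add_zero, zero_add]
  refine and_congr ?_ (and_congr ?_ ?_)
  · refine forall_congr' fun k => ?_
    push_cast
    ring_nf
  · refine forall_congr' fun k => ?_
    push_cast
    ring_nf
  · exact Iff.rfl

lemma acg_row_four (d : ℕ) (A : Matrix (Fin d) (Fin d) ℝ)
    (α β₁ β₂ γ τ : ℝ) (k l : Fin d) (j : Fin 6) :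
    ACGMatrix d A α β₁ β₂ γ τ (4, k) (j, l) = if j = 4 ∧ l = k then τ else 0 := by
  have h : ∀ j : Fin 6, ACGMatrix d A α β₁ β₂ γ τ (4, k) (j, l)
      = (![0, 0, 0, 0, τ • 1, 0] : Fin 6 → Matrix (Fin d) (Fin d) ℝ) j k l := by
    intro j
    fin_cases j <;> rfl
  rw [h]
  by_cases hj : j = 4
  · subst hj
    by_cases hl : l = k
    · subst hl
      simp
    · simp [hl, Matrix.one_apply_ne (Ne.symm hl)]
  · simp only [hj, false_and, if_false]
    fin_cases j
    · rfl
    · rfl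
    · rfl
    · rfl
    · exact absurd rfl hj
    · rfl

/-- For nonsingular `A`, the eigenvalues of the ACG block matrix `F`
are exactly the roots of the sixth-order polynomials
`(τ−λ)² [λ²(1−λ)² + (λ(α+β₁) − β₁(1+γ))² ξ²]` as `ξ²` ranges over `Sp(AᵀA)`. -/
theorem stmt3 (d : ℕ) (A : Matrix (Fin d) (Fin d) ℝ) (hA : A.det ≠ 0)
    (α β₁ β₂ γ τ : ℝ) (lam : ℂ) :
    lam ∈ spectrum ℂ ((ACGMatrix d A α β₁ β₂ γ τ).map (algebraMap ℝ ℂ)) ↔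
      ∃ ξsq ∈ spectrum ℝ (Aᵀ * A),
        ((τ : ℂ) - lam) ^ 2 *
            (lam ^ 2 * (1 - lam) ^ 2 +
              (lam * ((α : ℂ) + (β₁ : ℂ)) - (β₁ : ℂ) * (1 + (γ : ℂ))) ^ 2 * (ξsq : ℂ))
          = 0 := by
  set B := A.map (algebraMap ℝ ℂ) with hB
  have hBB : (Aᵀ * A).map (algebraMap ℝ ℂ) = Bᵀ * B := by
    rw [Matrix.map_mul, hB, Matrix.transpose_map]
  have hsym : (Aᵀ * A)ᵀ = Aᵀ * A := by simp
  have hherm : (Aᵀ * A).IsHermitian := by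
    rw [Matrix.IsHermitian, Matrix.conjTranspose_eq_transpose_of_trivial, hsym]
  constructor
  · intro h
    obtain ⟨v, hv, hev⟩ := (acg_mem_spectrum_iff_right _ _).1 h
    obtain ⟨⟨i0, k0⟩, hk0⟩ := Function.ne_iff.1 hv
    have hany : ∃ x, x ∈ spectrum ℝ (Aᵀ * A) := ⟨_, hherm.eigenvalues_mem_spectrum_real k0⟩
    obtain ⟨e0, e1, e2, e3, e4, e5⟩ := (acg_eigen_iff d A α β₁ β₂ γ τ lam v).1 hev
    rw [← hB] at e0 e1
    by_cases hτ : (τ : ℂ) = lam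
    · obtain ⟨x, hx⟩ := hany
      exact ⟨x, hx, by simp [hτ]⟩
    have z4 : (fun k => v (4, k)) = 0 := by
      rw [← sub_eq_zero, ← sub_smul, smul_eq_zero, sub_eq_zero] at e4
      exact e4.resolve_left hτ
    have z5 : (fun k => v (5, k)) = 0 := by
      rw [← sub_eq_zero, ← sub_smul, smul_eq_zero, sub_eq_zero] at e5
      exact e5.resolve_left hτ
    rw [z4, e2, e3] at e0
    rw [z5, e2, e3] at e1
    set v2 : Fin d → ℂ := fun k => v (2, k) with hv2
    set v3 : Fin d → ℂ := fun k => v (3, k) with hv3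
    set c : ℂ := lam * ((α : ℂ) + (β₁ : ℂ)) - (β₁ : ℂ) * (1 + (γ : ℂ)) with hc
    set p : ℂ := lam * (1 - lam) with hp
    have f0 : p • v2 = c • (B *ᵥ v3) := by
      rw [Matrix.mulVec_smul] at e0
      ext k
      have := congrFun e0 k
      simp only [Pi.add_apply, Pi.sub_apply, Pi.smul_apply, smul_eq_mul, Pi.zero_apply] at this ⊢
      rw [hp, hc]
      linear_combination this
    have f1 : p • v3 = -(c • (Bᵀ *ᵥ v2)) := by
      rw [Matrix.mulVec_smul] at e1
      ext k
      have := congrFun e1 k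
      simp only [Pi.add_apply, Pi.sub_apply, Pi.smul_apply, smul_eq_mul, Pi.zero_apply,
        Pi.neg_apply] at this ⊢
      rw [hp, hc]
      linear_combination this
    have g : (p ^ 2) • v3 = -(c ^ 2) • ((Bᵀ * B) *ᵥ v3) := by
      rw [pow_two, mul_smul, f1, smul_neg, smul_comm, ← Matrix.mulVec_smul, f0,
        Matrix.mulVec_smul, Matrix.mulVec_mulVec, smul_smul, neg_smul, pow_two]
    have goal' : ∀ x : ℝ, p ^ 2 + c ^ 2 * (x : ℂ) = 0 →
        (↑τ - lam) ^ 2 * (lam ^ 2 * (1 - lam) ^ 2 + c ^ 2 * (x : ℂ)) = 0 := by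
      intro x hx
      rw [hp, mul_pow] at hx
      rw [hx, mul_zero]
    have hne : v2 ≠ 0 ∨ v3 ≠ 0 := by
      by_contra! hcon
      obtain ⟨h2, h3⟩ := hcon
      rw [h2, smul_zero] at e2
      rw [h3, smul_zero] at e3
      apply hk0
      fin_cases i0
      exacts [congrFun e2 k0, congrFun e3 k0, congrFun h2 k0, congrFun h3 k0, congrFun z4 k0,
        congrFun z5 k0]
    by_cases hc0 : c = 0
    · have hp0 : p = 0 := by
        rw [hc0, zero_smul] at f0 f1
        rw [neg_zero] at f1
        rcases hne with h | h
        · exact (smul_eq_zero.1 f0).resolve_right h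
        · exact (smul_eq_zero.1 f1).resolve_right h
      obtain ⟨x, hx⟩ := hany
      exact ⟨x, hx, goal' x (by simp [hc0, hp0])⟩
    · have h3 : v3 ≠ 0 := by
        intro h3
        rw [h3, smul_zero, eq_comm, neg_eq_zero, smul_eq_zero] at f1
        have hz := f1.resolve_left hc0
        have hdet : Bᵀ.det ≠ 0 := by
          rw [Matrix.det_transpose, hB]
          have := RingHom.map_det (algebraMap ℝ ℂ) A
          rw [RingHom.mapMatrix_apply] at this
          rw [← this]
          simpa using hA
        exact (hne.resolve_right (by simpa using h3)) (Matrix.eq_zero_of_mulVec_eq_zero hdet hz)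
      have hμ : (-(p ^ 2) / c ^ 2) ∈ spectrum ℂ ((Aᵀ * A).map (algebraMap ℝ ℂ)) := by
        rw [acg_mem_spectrum_iff_right, hBB]
        refine ⟨v3, h3, ?_⟩
        have : ((c ^ 2) : ℂ) • ((Bᵀ * B) *ᵥ v3) = (c ^ 2) • ((-(p ^ 2) / c ^ 2) • v3) := by
          rw [smul_smul, mul_div_cancel₀ _ (pow_ne_zero 2 hc0), neg_smul, g, neg_smul, neg_neg]
        exact smul_right_injective _ (pow_ne_zero 2 hc0) this
      obtain ⟨x, hx, hμx⟩ := acg_real_of_spectrum _ hsym _ hμ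
      refine ⟨x, hx, goal' x ?_⟩
      rw [← hμx]
      field_simp
      ring
  · rintro ⟨x, hx, heq⟩
    obtain ⟨w, hw, hBw⟩ := (acg_mem_spectrum_iff_right _ _).1 ((acg_spectrum_map _ _).1 hx)
    rw [hBB] at hBw
    obtain ⟨k0, hk0⟩ := Function.ne_iff.1 hw
    set c : ℂ := lam * ((α : ℂ) + (β₁ : ℂ)) - (β₁ : ℂ) * (1 + (γ : ℂ)) with hc
    have hx0 : (x : ℂ) ≠ 0 := by
      intro h0
      have h0 : x = 0 := by exact_mod_cast h0
      rw [acg_mem_spectrum_iff, h0] at hx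
      simp [Matrix.det_neg, hA] at hx
    rcases mul_eq_zero.1 heq with h | h
    · have hτ : (τ : ℂ) = lam := sub_eq_zero.1 (pow_eq_zero_iff (two_ne_zero) |>.1 h)
      rw [acg_mem_spectrum_iff_left]
      refine ⟨Pi.single (4, k0) 1, ?_, ?_⟩
      · rw [Ne, Pi.single_eq_zero_iff]
        exact one_ne_zero
      ext ⟨j, l⟩
      rw [Matrix.single_one_vecMul, ← hτ]
      simp only [Matrix.row_apply, Matrix.map_apply, acg_row_four, Pi.smul_apply, Pi.single_apply,
        Prod.mk.injEq, smul_eq_mul]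
      split_ifs <;> simp
    · set p : ℂ := lam * (1 - lam) with hp
      have hpc : p ^ 2 + c ^ 2 * (x : ℂ) = 0 := by rw [hp, mul_pow]; exact h
      obtain ⟨u, f0, f1⟩ : ∃ u : Fin d → ℂ, p • u = c • (B *ᵥ w) ∧ p • w = -(c • (Bᵀ *ᵥ u)) := by
        by_cases hp0 : p = 0
        · have hc0 : c = 0 := by simpa [hp0, hx0] using hpc
          exact ⟨0, by simp [hp0, hc0], by simp [hp0]⟩
        · refine ⟨(c / p) • (B *ᵥ w), ?_, ?_⟩
          · rw [smul_smul, mul_div_cancel₀ _ hp0]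
          · rw [Matrix.mulVec_smul, Matrix.mulVec_mulVec, hBw, smul_smul, smul_smul, ← neg_smul]
            congr 1
            field_simp
            linear_combination hpc
      rw [acg_mem_spectrum_iff_right]
      refine ⟨fun q => (![lam • u, lam • w, u, w, 0, 0] : Fin 6 → Fin d → ℂ) q.1 q.2, ?_, ?_⟩
      · intro h0
        exact hk0 (congrFun h0 (3, k0))
      · rw [acg_eigen_iff, ← hB]
        simp only [Matrix.cons_val]
        refine ⟨?_, ?_, trivial, trivial, by ext k; simp, by ext k; simp⟩
        · change lam • u - _ • (B *ᵥ (lam • w)) + _ • (B *ᵥ w) - _ • (0 : Fin d → ℂ) = lam • lam • u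
          rw [Matrix.mulVec_smul]
          ext k
          have := congrFun f0 k
          simp only [Pi.add_apply, Pi.sub_apply, Pi.smul_apply, smul_eq_mul, Pi.zero_apply] at this ⊢
          rw [hp, hc] at this
          linear_combination this
        · change _ • (Bᵀ *ᵥ (lam • u)) + lam • w - _ • (Bᵀ *ᵥ u) + _ • (0 : Fin d → ℂ) = lam • lam • w
          rw [Matrix.mulVec_smul]
          ext k
          have := congrFun f1 k
          simp only [Pi.add_apply, Pi.sub_apply, Pi.smul_apply, smul_eq_mul, Pi.zero_apply,
            Pi.neg_apply] at this ⊢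
          rw [hp, hc] at this
          linear_combination this
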